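/- For every complex number α with Re(α) < 1, the double integral ∫₀^∞ ∫₀^∞ x^(−α) · y² · e^(−(x+y)²/4) dx dy converges and equals 2^(3−α) Γ((2−α)/2) / ((1−α)(3−α)). -/

import Mathlib

open MeasureTheory Set

/-- The integral over the open first quadrant, computed by slicing along the lines `x + y = s`. -/
lemma setIntegral_quadrant_eq_integral_antidiagonal {E : Type*} [NormedAddCommGroup E]
    [NormedSpace ℝ E] {f : ℝ × ℝ → E}
    (hf : IntegrableOn f (Ioi (0 : ℝ) ×ˢ Ioi (0 : ℝ)) volume) :
    ∫ q in Ioi (0 : ℝ) ×ˢ Ioi (0 : ℝ), f q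
      = ∫ s in Ioi (0 : ℝ), ∫ x in (0 : ℝ)..s, f (x, s - x) := by
  have hQ : MeasurableSet (Ioi (0 : ℝ) ×ˢ Ioi (0 : ℝ)) := measurableSet_Ioi.prod measurableSet_Ioi
  have hmp : MeasurePreserving (MeasurableEquiv.shearAddRight ℝ).symm
      (volume : Measure (ℝ × ℝ)) volume :=
    (measurePreserving_prod_add (volume : Measure ℝ) volume).symm (MeasurableEquiv.shearAddRight ℝ)
  have hshear (x s : ℝ) : (MeasurableEquiv.shearAddRight ℝ).symm (x, s) = (x, s - x) := by
    rw [MeasurableEquiv.symm_apply_eq]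
    change (x, s) = (x, x + (s - x))
    rw [add_sub_cancel]
  have hint := (hmp.integrable_comp_emb (MeasurableEquiv.measurableEmbedding _)).mpr
    ((integrable_indicator_iff hQ).mpr hf)
  rw [Function.comp_def] at hint
  rw [← integral_indicator hQ, ← hmp.integral_comp', Measure.volume_eq_prod,
    integral_prod_symm _ hint, ← integral_indicator measurableSet_Ioi]
  congr 1 with s
  simp only [hshear]
  by_cases hs : 0 < s
  · rw [indicator_of_mem (mem_Ioi.mpr hs), intervalIntegral.integral_of_le hs.le,
      integral_Ioc_eq_integral_Ioo, ← integral_indicator measurableSet_Ioo]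
    congr 1 with x
    simp only [indicator_apply, mem_prod, mem_Ioi, mem_Ioo, sub_pos]
  · rw [indicator_of_notMem (by simpa using hs)]
    refine integral_eq_zero_of_ae (Filter.Eventually.of_forall fun x => ?_)
    refine indicator_of_notMem ?_ _
    simp only [mem_prod, mem_Ioi, not_and, sub_pos]
    intro hx hxs
    exact hs (hx.trans hxs)

lemma Complex.integral_cpow_mul_exp_neg_sq_div_four {a : ℂ} (ha : 0 < a.re) :
    ∫ s in Ioi (0 : ℝ), (s : ℂ) ^ (a - 1) * Complex.exp (-((s : ℂ) ^ 2 / 4))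
      = 2 ^ (a - 1) * Complex.Gamma (a / 2) := by
  have ha2 : 0 < (a / 2).re := by simpa using ha
  have h := Complex.integral_cpow_mul_exp_neg_mul_Ioi ha2 (r := 1 / 4) (by norm_num)
  rw [← integral_comp_rpow_Ioi_of_pos two_pos] at h
  have h4 : (1 / ((1 / 4 : ℝ) : ℂ)) ^ (a / 2) = 2 * 2 ^ (a - 1) := by
    rw [Complex.cpow_sub _ _ two_ne_zero, Complex.cpow_one, mul_div_cancel₀ _ two_ne_zero]
    have h22 := Complex.mul_cpow_ofReal_nonneg zero_le_two zero_le_two (a / 2)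
    rw [← Complex.cpow_add _ _ (by norm_num), add_halves] at h22
    push_cast at h22
    rw [← h22]
    norm_num
  rw [h4, mul_assoc] at h
  refine mul_left_cancel₀ two_ne_zero (Eq.trans ?_ h)
  rw [← integral_const_mul]
  refine setIntegral_congr_fun measurableSet_Ioi fun s hs => ?_
  have hs0 : (s : ℂ) ≠ 0 := Complex.ofReal_ne_zero.mpr (ne_of_gt hs)
  have hpow : ((s : ℂ) ^ 2) ^ (a / 2 - 1) * s = (s : ℂ) ^ (a - 1) := by
    rw [sq, Complex.mul_cpow_ofReal_nonneg (le_of_lt hs) (le_of_lt hs), ← Complex.cpow_add _ _ hs0]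
    nth_rewrite 2 [← Complex.cpow_one (s : ℂ)]
    rw [← Complex.cpow_add _ _ hs0]
    congr 1
    ring
  have h21 : (2 : ℝ) - 1 = 1 := by norm_num
  simp only [h21, Real.rpow_one, Real.rpow_two, Complex.real_smul]
  push_cast
  rw [← hpow]
  ring_nf

lemma integrableOn_quadrant_cpow_mul_sq_mul_exp {α : ℂ} (hα : α.re < 1) :
    IntegrableOn
      (fun q : ℝ × ℝ =>
        (q.1 : ℂ) ^ (-α) * (q.2 : ℂ) ^ 2 * Complex.exp (-(((q.1 : ℂ) + (q.2 : ℂ)) ^ 2 / 4)))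
      (Ioi (0 : ℝ) ×ˢ Ioi (0 : ℝ)) volume := by
  have hx := integrableOn_rpow_mul_exp_neg_mul_sq (b := 1 / 4) (by norm_num) (s := -α.re)
    (by linarith)
  have hy := integrableOn_rpow_mul_exp_neg_mul_sq (b := 1 / 4) (by norm_num) (s := 2)
    (by norm_num)
  have hxy := Integrable.mul_prod hx hy
  rw [Measure.prod_restrict, ← Measure.volume_eq_prod] at hxy
  refine Integrable.mono' hxy (by fun_prop) ?_
  filter_upwards [ae_restrict_mem (measurableSet_Ioi.prod measurableSet_Ioi)] with q hq
  obtain ⟨h1, h2⟩ : 0 < q.1 ∧ 0 < q.2 := hq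
  have hexp : -(((q.1 : ℂ) + (q.2 : ℂ)) ^ 2 / 4) = ((-((q.1 + q.2) ^ 2 / 4) : ℝ) : ℂ) := by
    push_cast
    rfl
  rw [hexp, norm_mul, norm_mul, Complex.norm_cpow_eq_rpow_re_of_pos h1, norm_pow,
    Complex.norm_real, Complex.norm_exp_ofReal, Real.norm_of_nonneg h2.le, Complex.neg_re,
    Real.rpow_two, mul_mul_mul_comm, ← Real.exp_add]
  gcongr
  nlinarith [mul_pos h1 h2]

/-- The coefficient integral defining `ε₇,α` in Section 3.2 of the paper. -/
theorem stmt6 (α : ℂ) (hα : α.re < 1) :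
    IntegrableOn
      (fun q : ℝ × ℝ =>
        (q.1 : ℂ) ^ (-α) * (q.2 : ℂ) ^ 2 * Complex.exp (-(((q.1 : ℂ) + (q.2 : ℂ)) ^ 2 / 4)))
      (Ioi (0 : ℝ) ×ˢ Ioi (0 : ℝ)) volume ∧
    ∫ q in Ioi (0 : ℝ) ×ˢ Ioi (0 : ℝ),
        (q.1 : ℂ) ^ (-α) * (q.2 : ℂ) ^ 2 * Complex.exp (-(((q.1 : ℂ) + (q.2 : ℂ)) ^ 2 / 4))
      = 2 ^ (3 - α) * Complex.Gamma ((2 - α) / 2) / ((1 - α) * (3 - α)) := by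
  have hint := integrableOn_quadrant_cpow_mul_sq_mul_exp hα
  refine ⟨hint, ?_⟩
  have hne (n : ℝ) (hn : 1 ≤ n) : (n : ℂ) - α ≠ 0 := fun h => by
    have := congrArg Complex.re h
    simp only [Complex.sub_re, Complex.ofReal_re, Complex.zero_re] at this
    linarith
  have h1 : 1 - α ≠ 0 := by simpa using hne 1 le_rfl
  have h2 : 2 - α ≠ 0 := by simpa using hne 2 one_le_two
  have h3 : 3 - α ≠ 0 := by simpa using hne 3 (by norm_num)
  have hbeta : Complex.betaIntegral (1 - α) 3 = 2 / ((1 - α) * (2 - α) * (3 - α)) := by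
    have h := Complex.betaIntegral_eval_nat_add_one_right (u := 1 - α) (by simpa using hα) 2
    simp only [Finset.prod_range_succ, Finset.prod_range_zero, Nat.factorial] at h
    convert h using 2 <;> push_cast <;> ring
  have hslice : ∀ s ∈ Ioi (0 : ℝ),
      ∫ x in (0 : ℝ)..s, (x : ℂ) ^ (-α) * ((s - x : ℝ) : ℂ) ^ 2
          * Complex.exp (-(((x : ℂ) + ((s - x : ℝ) : ℂ)) ^ 2 / 4))
        = (s : ℂ) ^ ((4 - α) - 1) * Complex.exp (-((s : ℂ) ^ 2 / 4))
          * Complex.betaIntegral (1 - α) 3 := by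
    intro s hs
    have h := Complex.betaIntegral_scaled (1 - α) 3 hs
    rw [show 1 - α + 3 - 1 = 4 - α - 1 by ring] at h
    rw [mul_right_comm, ← h, ← intervalIntegral.integral_mul_const]
    congr 1 with x
    rw [show (3 : ℂ) - 1 = (2 : ℕ) by norm_num, Complex.cpow_natCast,
      show 1 - α - 1 = -α by ring]
    push_cast
    rw [add_sub_cancel]
  have hGamma : Complex.Gamma ((4 - α) / 2) = (2 - α) / 2 * Complex.Gamma ((2 - α) / 2) := by
    rw [← Complex.Gamma_add_one _ (div_ne_zero h2 two_ne_zero)]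
    congr 1
    ring
  rw [setIntegral_quadrant_eq_integral_antidiagonal hint,
    setIntegral_congr_fun measurableSet_Ioi hslice, integral_mul_const,
    Complex.integral_cpow_mul_exp_neg_sq_div_four (by simp; linarith), hbeta, hGamma,
    show 4 - α - 1 = 3 - α by ring]
  field_simp
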